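/- Let a be a real number with 0 < a < 1 and let n, m ∈ ℤ. Then the family k ↦ a^k · j_{q^n}(q^k;a;q) · j_{q^m}(q^k;a;q) is summable over k ∈ ℤ, and ∑_{k∈ℤ} a^k · j_{q^n}(q^k;a;q) · j_{q^m}(q^k;a;q) = δ_{n,m} · a^{-n} · (q;q)_∞² / (a;q)_∞², where δ_{n,m} is the Kronecker delta. -/

import Mathlib

/-- The q-shifted factorial `(a;q)_n = ∏_{j=0}^{n-1} (1 - a q^j)`. -/
noncomputable def qPoch (a q : ℂ) (n : ℕ) : ℂ := ∏ j ∈ Finset.range n, (1 - a * q ^ j)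

/-- The infinite q-shifted factorial `(a;q)_∞ = ∏_{j=0}^∞ (1 - a q^j)`. -/
noncomputable def qPochInf (a q : ℂ) : ℂ := ∏' j : ℕ, (1 - a * q ^ j)

/-- The little q-Bessel (Hahn-Exton q-Bessel) function
`j_γ(x;a;q) = ∑_{n≥0} (-1)^n q^{n(n-1)/2} / ((a;q)_n (q;q)_n) (qγx)^n`. -/
noncomputable def littleQBessel (q a γ x : ℂ) : ℂ :=
  ∑' n : ℕ, (-1) ^ n * q ^ (n * (n - 1) / 2) /
    (qPoch a q n * qPoch q q n) * (q * γ * x) ^ n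

open Filter Topology

/-- The coefficient of `x ^ k` in Euler's expansion of `(x;q)_∞`. -/
noncomputable def eulerCoeff (q : ℂ) (k : ℕ) : ℂ :=
  (-1) ^ k * q ^ (k * (k - 1) / 2) / qPoch q q k

lemma qPoch_succ (a q : ℂ) (n : ℕ) : qPoch a q (n + 1) = qPoch a q n * (1 - a * q ^ n) :=
  Finset.prod_range_succ _ _

lemma one_sub_mul_pow_ne_zero {q a : ℂ} (hq : ‖q‖ < 1) (ha : ‖a‖ < 1) (n : ℕ) :
    1 - a * q ^ n ≠ 0 := by
  intro h
  have h1 : ‖a * q ^ n‖ < 1 := by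
    rw [norm_mul, norm_pow]
    exact mul_lt_one_of_nonneg_of_lt_one_left (norm_nonneg _) ha
      (pow_le_one₀ (norm_nonneg _) hq.le)
  rw [← sub_eq_zero.mp h, norm_one] at h1
  exact lt_irrefl _ h1

lemma qPoch_ne_zero {q a : ℂ} (hq : ‖q‖ < 1) (ha : ‖a‖ < 1) (n : ℕ) : qPoch a q n ≠ 0 :=
  Finset.prod_ne_zero_iff.mpr fun j _ => one_sub_mul_pow_ne_zero hq ha j

lemma eulerCoeff_zero (q : ℂ) : eulerCoeff q 0 = 1 := by simp [eulerCoeff, qPoch]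

lemma eulerCoeff_succ {q : ℂ} (hq : ‖q‖ < 1) (k : ℕ) :
    eulerCoeff q (k + 1) * (1 - q ^ (k + 1)) = -q ^ k * eulerCoeff q k := by
  have h1 := qPoch_ne_zero hq hq k
  have h2 := one_sub_mul_pow_ne_zero hq hq k
  have h3 : q ^ (k + 1) = q * q ^ k := pow_succ' q k
  rw [eulerCoeff, eulerCoeff, Nat.triangle_succ, qPoch_succ, h3]
  field_simp
  ring

lemma eulerCoeff_ne_zero {q : ℂ} (hq0 : q ≠ 0) (hq : ‖q‖ < 1) (k : ℕ) : eulerCoeff q k ≠ 0 :=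
  div_ne_zero (mul_ne_zero (pow_ne_zero _ (by norm_num)) (pow_ne_zero _ hq0))
    (qPoch_ne_zero hq hq k)

lemma summable_eulerCoeff_mul_pow {q : ℂ} (hq0 : q ≠ 0) (hq : ‖q‖ < 1) (x : ℂ) :
    Summable fun k => eulerCoeff q k * x ^ k := by
  rcases eq_or_ne x 0 with rfl | hx
  · exact summable_of_ne_finset_zero (s := {0}) fun k hk => by
      simp [show k ≠ 0 by simpa using hk]
  refine summable_of_ratio_test_tendsto_lt_one (l := 0) zero_lt_one
    (.of_forall fun k => mul_ne_zero (eulerCoeff_ne_zero hq0 hq k) (pow_ne_zero _ hx)) ?_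
  have h1 : Tendsto (fun k : ℕ => q ^ k) atTop (𝓝 0) := tendsto_pow_atTop_nhds_zero_of_norm_lt_one hq
  have h2 : Tendsto (fun k : ℕ => ‖-q ^ k / (1 - q * q ^ k) * x‖) atTop (𝓝 0) := by
    have := ((h1.neg.div (tendsto_const_nhds.sub (h1.const_mul q)) (by simp :
      (1 : ℂ) - q * 0 ≠ 0)).mul_const x).norm
    simpa using this
  refine h2.congr fun k => ?_
  rw [← norm_div]
  congr 1
  have h3 := one_sub_mul_pow_ne_zero hq hq k
  have h4 := eulerCoeff_succ hq k
  have h5 := eulerCoeff_ne_zero hq0 hq k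
  rw [pow_succ' q k] at h4
  rw [eq_div_iff (mul_ne_zero h5 (pow_ne_zero _ hx)), pow_succ x k, eq_div_of_mul_eq h3 h4]
  ring

lemma summable_norm_eulerCoeff {q : ℂ} (hq0 : q ≠ 0) (hq : ‖q‖ < 1) :
    Summable fun k => ‖eulerCoeff q k‖ := by
  simpa using (summable_eulerCoeff_mul_pow hq0 hq 1).norm

lemma tsum_eulerCoeff_mul_pow {q : ℂ} (hq0 : q ≠ 0) (hq : ‖q‖ < 1) (x : ℂ) :
    ∑' k, eulerCoeff q k * x ^ k = (1 - x) * ∑' k, eulerCoeff q k * (x * q) ^ k := by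
  have s1 := summable_eulerCoeff_mul_pow hq0 hq x
  have s2 := summable_eulerCoeff_mul_pow hq0 hq (x * q)
  have h : ∑' k, (eulerCoeff q k * x ^ k - eulerCoeff q k * (x * q) ^ k) =
      -x * ∑' k, eulerCoeff q k * (x * q) ^ k := by
    rw [(s1.sub s2).tsum_eq_zero_add, ← tsum_mul_left]
    simp only [pow_zero, sub_self, zero_add]
    refine tsum_congr fun k => ?_
    have h4 := eulerCoeff_succ hq k
    simp only [mul_pow]
    linear_combination x ^ (k + 1) * h4
  rw [s1.tsum_sub s2] at h
  linear_combination h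

lemma tsum_eulerCoeff_eq_prod {q : ℂ} (hq0 : q ≠ 0) (hq : ‖q‖ < 1) (x : ℂ) (n : ℕ) :
    ∑' k, eulerCoeff q k * x ^ k = qPoch x q n * ∑' k, eulerCoeff q k * (x * q ^ n) ^ k := by
  induction n with
  | zero => simp [qPoch]
  | succ n ih =>
    rw [ih, tsum_eulerCoeff_mul_pow hq0 hq (x * q ^ n), qPoch_succ, pow_succ]
    ring_nf

lemma tendsto_tsum_eulerCoeff {q : ℂ} (hq0 : q ≠ 0) (hq : ‖q‖ < 1) (x : ℂ) :
    Tendsto (fun n : ℕ => ∑' k, eulerCoeff q k * (x * q ^ n) ^ k) atTop (𝓝 1) := by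
  have h1 : Tendsto (fun n : ℕ => x * q ^ n) atTop (𝓝 0) := by
    simpa using (tendsto_pow_atTop_nhds_zero_of_norm_lt_one hq).const_mul x
  have h2 : ∑' k, eulerCoeff q k * (0 : ℂ) ^ k = 1 := by
    rw [tsum_eq_single 0 fun k hk => by simp [hk]]
    simp [eulerCoeff_zero]
  rw [← h2]
  refine tendsto_tsum_of_dominated_convergence (summable_eulerCoeff_mul_pow hq0 hq x).norm
    (fun k => (h1.pow k).const_mul _) (.of_forall fun n k => ?_)
  rw [norm_mul, norm_mul, norm_pow, norm_pow, norm_mul, norm_pow]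
  gcongr
  exact mul_le_of_le_one_right (norm_nonneg _) (pow_le_one₀ (norm_nonneg _) hq.le)

/-- Euler's expansion of the infinite `q`-shifted factorial. -/
lemma qPochInf_eq_tsum {q : ℂ} (hq0 : q ≠ 0) (hq : ‖q‖ < 1) (x : ℂ) :
    qPochInf x q = ∑' k, eulerCoeff q k * x ^ k := by
  have hm : Multipliable fun j : ℕ => 1 - x * q ^ j := by
    simp only [sub_eq_add_neg]
    refine multipliable_one_add_of_summable ?_
    simpa using (summable_geometric_of_lt_one (norm_nonneg q) hq).mul_left ‖x‖
  have h1 := hm.tendsto_prod_tprod_nat.mul (tendsto_tsum_eulerCoeff hq0 hq x)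
  rw [mul_one] at h1
  exact tendsto_nhds_unique h1
    (tendsto_const_nhds.congr fun n => tsum_eulerCoeff_eq_prod hq0 hq x n)

lemma qPochInf_eq_qPoch_mul {q : ℂ} (hq0 : q ≠ 0) (hq : ‖q‖ < 1) (x : ℂ) (n : ℕ) :
    qPochInf x q = qPoch x q n * qPochInf (x * q ^ n) q := by
  rw [qPochInf_eq_tsum hq0 hq, qPochInf_eq_tsum hq0 hq, ← tsum_eulerCoeff_eq_prod hq0 hq]

lemma qPochInf_ne_zero {q a : ℂ} (hq0 : q ≠ 0) (hq : ‖q‖ < 1) (ha : ‖a‖ < 1) :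
    qPochInf a q ≠ 0 := by
  obtain ⟨n, hn⟩ := ((tendsto_tsum_eulerCoeff hq0 hq a).eventually_ne one_ne_zero).exists
  rw [qPochInf_eq_tsum hq0 hq, tsum_eulerCoeff_eq_prod hq0 hq a n]
  exact mul_ne_zero (qPoch_ne_zero hq ha n) hn

lemma norm_qPochInf_le {q x : ℂ} (hq0 : q ≠ 0) (hq : ‖q‖ < 1) (hx : ‖x‖ ≤ 1) :
    ‖qPochInf x q‖ ≤ ∑' k, ‖eulerCoeff q k‖ := by
  rw [qPochInf_eq_tsum hq0 hq]
  refine tsum_of_norm_bounded (summable_norm_eulerCoeff hq0 hq).hasSum fun k => ?_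
  rw [norm_mul, norm_pow]
  exact mul_le_of_le_one_right (norm_nonneg _) (pow_le_one₀ (norm_nonneg _) hx)

/-- The Heine-type transformation of the little `q`-Bessel function. -/
lemma qPochInf_mul_littleQBessel {q a : ℂ} (hq0 : q ≠ 0) (hq : ‖q‖ < 1) (ha : ‖a‖ < 1)
    (γ x : ℂ) :
    qPochInf a q * littleQBessel q a γ x =
      ∑' j : ℕ, eulerCoeff q j * a ^ j * qPochInf (q * γ * x * q ^ j) q := by
  set y := q * γ * x
  have h1 (k : ℕ) : qPochInf a q * ((-1) ^ k * q ^ (k * (k - 1) / 2) /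
      (qPoch a q k * qPoch q q k) * y ^ k) =
      ∑' j : ℕ, eulerCoeff q k * y ^ k * (eulerCoeff q j * (a * q ^ k) ^ j) := by
    rw [tsum_mul_left, ← qPochInf_eq_tsum hq0 hq, qPochInf_eq_qPoch_mul hq0 hq a k, eulerCoeff]
    have := qPoch_ne_zero hq ha k
    have := qPoch_ne_zero hq hq k
    field_simp
  have hs : Summable (Function.uncurry fun k j : ℕ =>
      eulerCoeff q k * y ^ k * (eulerCoeff q j * (a * q ^ k) ^ j)) := by
    refine .of_norm_bounded ((summable_eulerCoeff_mul_pow hq0 hq y).norm.mul_of_nonneg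
      (summable_norm_eulerCoeff hq0 hq) (fun _ => norm_nonneg _) fun _ => norm_nonneg _) ?_
    rintro ⟨k, j⟩
    simp only [Function.uncurry_apply_pair]
    rw [norm_mul (eulerCoeff q k * y ^ k), norm_mul (eulerCoeff q j), norm_pow]
    have : ‖a * q ^ k‖ ≤ 1 := by
      rw [norm_mul, norm_pow]
      exact mul_le_one₀ ha.le (by positivity) (pow_le_one₀ (norm_nonneg _) hq.le)
    gcongr
    exact mul_le_of_le_one_right (norm_nonneg _) (pow_le_one₀ (norm_nonneg _) this)
  rw [littleQBessel, ← tsum_mul_left, tsum_congr h1, ← hs.tsum_comm]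
  refine tsum_congr fun j => ?_
  rw [qPochInf_eq_tsum hq0 hq, ← tsum_mul_left]
  refine tsum_congr fun k => ?_
  ring

/-- The value `(q^{M+1};q)_∞`, which vanishes for negative integers `M`. -/
noncomputable def qTail (q : ℂ) (M : ℤ) : ℂ := qPochInf (q ^ (M + 1)) q

lemma qTail_zero (q : ℂ) : qTail q 0 = qPochInf q q := by simp [qTail]

lemma qTail_sub_one {q : ℂ} (hq0 : q ≠ 0) (hq : ‖q‖ < 1) (M : ℤ) :
    qTail q (M - 1) = (1 - q ^ M) * qTail q M := by
  rw [qTail, qTail, sub_add_cancel, qPochInf_eq_qPoch_mul hq0 hq _ 1, zpow_add_one₀ hq0]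
  simp [qPoch]

lemma qTail_of_neg {q : ℂ} (hq0 : q ≠ 0) (hq : ‖q‖ < 1) {M : ℤ} (hM : M < 0) :
    qTail q M = 0 := by
  induction M, Int.le_sub_one_of_lt hM using Int.leInductionDown with
  | base => simpa using qTail_sub_one hq0 hq 0
  | pred M hM ih => rw [qTail_sub_one hq0 hq, ih (by lia), mul_zero]

lemma norm_qTail_le {q : ℂ} (hq0 : q ≠ 0) (hq : ‖q‖ < 1) (M : ℤ) :
    ‖qTail q M‖ ≤ ∑' k, ‖eulerCoeff q k‖ := by
  rcases lt_or_ge M 0 with hM | hM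
  · rw [qTail_of_neg hq0 hq hM, norm_zero]
    exact tsum_nonneg fun _ => norm_nonneg _
  · refine norm_qPochInf_le hq0 hq ?_
    lift M to ℕ using hM
    rw [← Nat.cast_add_one, zpow_natCast, norm_pow]
    exact pow_le_one₀ (norm_nonneg _) hq.le

lemma summable_eulerCoeff_mul_qTail {q : ℂ} (hq0 : q ≠ 0) (hq : ‖q‖ < 1) (L : ℤ) :
    Summable fun i : ℕ => eulerCoeff q i * qTail q (L - i) := by
  refine .of_norm_bounded ((summable_norm_eulerCoeff hq0 hq).mul_right
    (∑' k, ‖eulerCoeff q k‖)) fun i => ?_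
  rw [norm_mul]
  exact mul_le_mul_of_nonneg_left (norm_qTail_le hq0 hq _) (norm_nonneg _)

lemma tsum_eulerCoeff_mul_qTail_step {q : ℂ} (hq0 : q ≠ 0) (hq : ‖q‖ < 1) (L : ℤ) :
    (1 - q ^ L) * ∑' i : ℕ, eulerCoeff q i * qTail q (L - i) =
      (1 - q ^ (L - 1)) * ∑' i : ℕ, eulerCoeff q i * qTail q (L - 1 - i) := by
  have s0 := summable_eulerCoeff_mul_qTail hq0 hq L
  have s1 := summable_eulerCoeff_mul_qTail hq0 hq (L - 1)
  have h : ∑' i : ℕ, ((1 - q ^ L) * (eulerCoeff q i * qTail q (L - i)) -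
      eulerCoeff q i * qTail q (L - 1 - i)) =
      -q ^ (L - 1) * ∑' i : ℕ, eulerCoeff q i * qTail q (L - 1 - i) := by
    rw [((s0.mul_left _).sub s1).tsum_eq_zero_add, ← tsum_mul_left]
    have h0 : (1 - q ^ L) * (eulerCoeff q 0 * qTail q (L - (0 : ℕ))) -
        eulerCoeff q 0 * qTail q (L - 1 - (0 : ℕ)) = 0 := by
      simp only [Nat.cast_zero, sub_zero]
      rw [qTail_sub_one hq0 hq]
      ring
    rw [h0, zero_add]
    refine tsum_congr fun i => ?_
    have e1 : L - 1 - ((i + 1 : ℕ) : ℤ) = L - ((i + 1 : ℕ) : ℤ) - 1 := by ring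
    have e2 : L - 1 - (i : ℤ) = L - ((i + 1 : ℕ) : ℤ) := by push_cast; ring
    have e3 : q ^ L = q ^ (L - ((i + 1 : ℕ) : ℤ)) * q ^ (i + 1) := by
      rw [← zpow_natCast q (i + 1), ← zpow_add₀ hq0]
      simp
    have e4 : q ^ (L - 1) = q ^ (L - ((i + 1 : ℕ) : ℤ)) * q ^ i := by
      rw [← zpow_natCast q i, ← zpow_add₀ hq0]
      congr 1
      push_cast
      ring
    rw [e1, e2, e3, e4, qTail_sub_one hq0 hq]
    linear_combination (q ^ (L - ((i + 1 : ℕ) : ℤ)) * qTail q (L - ((i + 1 : ℕ) : ℤ))) *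
      eulerCoeff_succ hq i
  rw [(s0.mul_left _).tsum_sub s1, tsum_mul_left] at h
  linear_combination h

lemma one_sub_zpow_ne_zero {q : ℂ} (hq : ‖q‖ < 1) {L : ℤ} (hL : 0 < L) : 1 - q ^ L ≠ 0 := by
  obtain ⟨n, rfl⟩ : ∃ n : ℕ, L = (n + 1 : ℕ) := ⟨L.toNat - 1, by lia⟩
  rw [zpow_natCast, pow_succ']
  exact one_sub_mul_pow_ne_zero hq hq n

/-- The two Euler expansions are inverse to each other under convolution. -/
lemma tsum_eulerCoeff_mul_qTail {q : ℂ} (hq0 : q ≠ 0) (hq : ‖q‖ < 1) (L : ℤ) :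
    ∑' i : ℕ, eulerCoeff q i * qTail q (L - i) = if L = 0 then qPochInf q q else 0 := by
  rcases lt_trichotomy L 0 with hL | rfl | hL
  · rw [if_neg hL.ne, ← tsum_zero (β := ℕ)]
    exact tsum_congr fun i => by rw [qTail_of_neg hq0 hq (by lia), mul_zero]
  · rw [if_pos rfl, tsum_eq_single 0]
    · simp [eulerCoeff_zero, qTail_zero]
    · exact fun i hi => by rw [qTail_of_neg hq0 hq (by lia), mul_zero]
  · rw [if_neg hL.ne']
    induction L, Int.add_one_le_of_lt hL using Int.leInduction with
    | base =>
      have h := tsum_eulerCoeff_mul_qTail_step hq0 hq 1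
      rw [sub_self, zpow_zero, sub_self, zero_mul] at h
      exact (mul_eq_zero.mp h).resolve_left (one_sub_zpow_ne_zero hq one_pos)
    | succ L hL' ih =>
      have h := tsum_eulerCoeff_mul_qTail_step hq0 hq (L + 1)
      rw [add_sub_cancel_right, ih (by lia), mul_zero] at h
      exact (mul_eq_zero.mp h).resolve_left (one_sub_zpow_ne_zero hq hL)

lemma summable_zpow_mul_qTail {q a : ℂ} (hq0 : q ≠ 0) (hq : ‖q‖ < 1) (ha : ‖a‖ < 1) :
    Summable fun M : ℤ => a ^ M * qTail q M := by
  refine (Function.Injective.summable_iff (Nat.cast_injective (R := ℤ)) fun M hM => ?_).mp ?_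
  · have hM : M < 0 := by
      by_contra! h
      exact hM ⟨M.toNat, by simpa using h⟩
    rw [qTail_of_neg hq0 hq hM, mul_zero]
  · refine .of_norm_bounded ((summable_geometric_of_lt_one (norm_nonneg a) ha).mul_right
      (∑' k, ‖eulerCoeff q k‖)) fun i => ?_
    rw [Function.comp_apply, norm_mul, zpow_natCast, norm_pow]
    exact mul_le_mul_of_nonneg_left (norm_qTail_le hq0 hq _) (by positivity)

lemma summable_eulerCoeff_mul_pow_mul_qTail {q a : ℂ} (hq0 : q ≠ 0) (hq : ‖q‖ < 1) (L : ℤ) :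
    Summable fun j : ℕ => ‖eulerCoeff q j * a ^ j * qTail q (L + j)‖ := by
  refine .of_nonneg_of_le (fun _ => norm_nonneg _) (fun j => ?_)
    ((summable_eulerCoeff_mul_pow hq0 hq a).norm.mul_right (∑' k, ‖eulerCoeff q k‖))
  rw [norm_mul]
  exact mul_le_mul_of_nonneg_left (norm_qTail_le hq0 hq _) (norm_nonneg _)

lemma qPochInf_mul_littleQBessel_zpow {q a : ℂ} (hq0 : q ≠ 0) (hq : ‖q‖ < 1) (ha : ‖a‖ < 1)
    (n k : ℤ) :
    qPochInf a q * littleQBessel q a (q ^ n) (q ^ k) =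
      ∑' j : ℕ, eulerCoeff q j * a ^ j * qTail q (k + n + j) := by
  rw [qPochInf_mul_littleQBessel hq0 hq ha]
  refine tsum_congr fun j => ?_
  rw [qTail, ← zpow_one_add₀ hq0, ← zpow_add₀ hq0, ← zpow_natCast q j, ← zpow_add₀ hq0]
  ring_nf

/-- The bijection substituting `M = k + n + i` for the summation variable `k`. -/
def tripleShift (n : ℤ) : (ℤ × ℕ) × ℕ ≃ ℤ × (ℕ × ℕ) where
  toFun p := (p.1.1 - n - p.2, (p.2, p.1.2))
  invFun p := ((p.1 + n + p.2.1, p.2.2), p.2.1)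
  left_inv p := Prod.ext (Prod.ext (by dsimp only; ring) rfl) rfl
  right_inv p := Prod.ext (by dsimp only; ring) rfl

/-- The terms of the product of two transformed little `q`-Bessel functions, multiplied by `a ^ k`
and summed over `k`. -/
noncomputable def productTerm (q a : ℂ) (n m : ℤ) (p : ℤ × (ℕ × ℕ)) : ℂ :=
  a ^ p.1 * ((eulerCoeff q p.2.1 * a ^ p.2.1 * qTail q (p.1 + n + p.2.1)) *
    (eulerCoeff q p.2.2 * a ^ p.2.2 * qTail q (p.1 + m + p.2.2)))

lemma productTerm_tripleShift {q a : ℂ} (ha0 : a ≠ 0) (n m M : ℤ) (j i : ℕ) :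
    productTerm q a n m (tripleShift n ((M, j), i)) =
      a ^ (-n) * ((a ^ M * qTail q M) * (eulerCoeff q j * a ^ j)) *
        (eulerCoeff q i * qTail q (M - n + m + j - i)) := by
  simp only [productTerm, tripleShift, Equiv.coe_fn_mk]
  have e1 : M - n - i + n + i = M := by ring
  have e2 : M - n - i + m + j = M - n + m + j - i := by ring
  have e3 : a ^ (M - n - i) * a ^ i = a ^ (-n) * a ^ M := by
    rw [← zpow_natCast a i, ← zpow_add₀ ha0, ← zpow_add₀ ha0]
    ring_nf
  rw [e1, e2]
  linear_combination (eulerCoeff q i * qTail q M * eulerCoeff q j * a ^ j *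
    qTail q (M - n + m + j - i)) * e3

lemma summable_productTerm_tripleShift {q a : ℂ} (hq0 : q ≠ 0) (hq : ‖q‖ < 1) (ha0 : a ≠ 0)
    (ha : ‖a‖ < 1) (n m : ℤ) :
    Summable fun p => productTerm q a n m (tripleShift n p) := by
  have hMj : Summable fun p : ℤ × ℕ =>
      a ^ (-n) * ((a ^ p.1 * qTail q p.1) * (eulerCoeff q p.2 * a ^ p.2)) :=
    (summable_mul_of_summable_norm (summable_zpow_mul_qTail hq0 hq ha).norm
      (summable_eulerCoeff_mul_pow hq0 hq a).norm).mul_left _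
  refine .of_norm_bounded ((hMj.norm.mul_of_nonneg (summable_norm_eulerCoeff hq0 hq)
    (fun _ => norm_nonneg _) fun _ => norm_nonneg _).mul_right (∑' k, ‖eulerCoeff q k‖)) ?_
  rintro ⟨⟨M, j⟩, i⟩
  rw [productTerm_tripleShift ha0, norm_mul, norm_mul (eulerCoeff q i), ← mul_assoc]
  exact mul_le_mul_of_nonneg_left (norm_qTail_le hq0 hq _) (by positivity)

lemma tsum_productTerm {q a : ℂ} (hq0 : q ≠ 0) (hq : ‖q‖ < 1) (ha0 : a ≠ 0)
    (ha : ‖a‖ < 1) (n m : ℤ) :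
    ∑' p, productTerm q a n m p = (if n = m then 1 else 0) * a ^ (-n) * qPochInf q q ^ 2 := by
  have hG := summable_productTerm_tripleShift hq0 hq ha0 ha n m
  have hi (M : ℤ) (j : ℕ) : ∑' i, productTerm q a n m (tripleShift n ((M, j), i)) =
      a ^ (-n) * ((a ^ M * qTail q M) * (eulerCoeff q j * a ^ j)) *
        if M - n + m + j = 0 then qPochInf q q else 0 := by
    simp only [productTerm_tripleShift ha0]
    rw [tsum_mul_left, tsum_eulerCoeff_mul_qTail hq0 hq]
  have hj (j : ℕ) : ∑' M : ℤ, ∑' i, productTerm q a n m (tripleShift n ((M, j), i)) =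
      a ^ (-m) * qPochInf q q * (eulerCoeff q j * qTail q (n - m - j)) := by
    rw [tsum_eq_single (n - m - j) fun M hM => by
      rw [hi, if_neg (fun h => hM (by linarith)), mul_zero]]
    rw [hi, if_pos (by ring)]
    have e : a ^ (-n) * (a ^ (n - m - j) * a ^ j) = a ^ (-m) := by
      rw [← zpow_natCast a j, ← zpow_add₀ ha0, ← zpow_add₀ ha0]
      ring_nf
    linear_combination (qTail q (n - m - j) * eulerCoeff q j * qPochInf q q) * e
  have hH : Summable (Function.uncurry fun (M : ℤ) (j : ℕ) =>
      ∑' i, productTerm q a n m (tripleShift n ((M, j), i))) := hG.prod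
  rw [← (tripleShift n).tsum_eq, hG.tsum_prod, hG.prod.tsum_prod, ← hH.tsum_comm, tsum_congr hj,
    tsum_mul_left, tsum_eulerCoeff_mul_qTail hq0 hq]
  by_cases hnm : n = m
  · subst hnm
    simp
    ring
  · simp [hnm, sub_eq_zero]

lemma tsum_productTerm_fiber {q a : ℂ} (hq0 : q ≠ 0) (hq : ‖q‖ < 1) (ha : ‖a‖ < 1) (n m k : ℤ) :
    ∑' p, productTerm q a n m (k, p) = a ^ k * littleQBessel q a (q ^ n) (q ^ k) *
      littleQBessel q a (q ^ m) (q ^ k) * qPochInf a q ^ 2 := by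
  simp only [productTerm]
  rw [tsum_mul_left, ← tsum_mul_tsum_of_summable_norm
    (summable_eulerCoeff_mul_pow_mul_qTail hq0 hq _)
    (summable_eulerCoeff_mul_pow_mul_qTail hq0 hq _),
    ← qPochInf_mul_littleQBessel_zpow hq0 hq ha, ← qPochInf_mul_littleQBessel_zpow hq0 hq ha]
  ring

lemma hasSum_littleQBessel_mul {q a : ℂ} (hq0 : q ≠ 0) (hq : ‖q‖ < 1) (ha0 : a ≠ 0)
    (ha : ‖a‖ < 1) (n m : ℤ) :
    HasSum (fun k : ℤ => a ^ k * littleQBessel q a (q ^ n) (q ^ k) *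
        littleQBessel q a (q ^ m) (q ^ k))
      ((if n = m then 1 else 0) * a ^ (-n) * qPochInf q q ^ 2 / qPochInf a q ^ 2) := by
  have hA : qPochInf a q ^ 2 ≠ 0 := pow_ne_zero _ (qPochInf_ne_zero hq0 hq ha)
  have hF : Summable (productTerm q a n m) :=
    (tripleShift n).summable_iff.mp (summable_productTerm_tripleShift hq0 hq ha0 ha n m)
  have h : HasSum (fun k : ℤ => ∑' p, productTerm q a n m (k, p)) (∑' p, productTerm q a n m p) :=
    hF.hasSum.prod_fiberwise fun k => (hF.prod_factor k).hasSum
  rw [tsum_productTerm hq0 hq ha0 ha] at h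
  have hk : (fun k : ℤ => a ^ k * littleQBessel q a (q ^ n) (q ^ k) *
        littleQBessel q a (q ^ m) (q ^ k)) =
      fun k => (∑' p, productTerm q a n m (k, p)) * (qPochInf a q ^ 2)⁻¹ := by
    funext k
    rw [tsum_productTerm_fiber hq0 hq ha, mul_inv_cancel_right₀ hA]
  rw [hk, div_eq_mul_inv]
  exact h.mul_right _

theorem littleQBessel_orthogonality (q a : ℝ) (hq0 : 0 < q) (hq1 : q < 1)
    (ha0 : 0 < a) (ha1 : a < 1) (n m : ℤ) :
    Summable (fun k : ℤ => (a : ℂ) ^ k *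
        littleQBessel (q : ℂ) (a : ℂ) ((q : ℂ) ^ n) ((q : ℂ) ^ k) *
        littleQBessel (q : ℂ) (a : ℂ) ((q : ℂ) ^ m) ((q : ℂ) ^ k)) ∧
    ∑' k : ℤ, (a : ℂ) ^ k *
        littleQBessel (q : ℂ) (a : ℂ) ((q : ℂ) ^ n) ((q : ℂ) ^ k) *
        littleQBessel (q : ℂ) (a : ℂ) ((q : ℂ) ^ m) ((q : ℂ) ^ k) =
      (if n = m then 1 else 0) * (a : ℂ) ^ (-n) *
        (qPochInf (q : ℂ) (q : ℂ)) ^ 2 / (qPochInf (a : ℂ) (q : ℂ)) ^ 2 := by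
  have hq0' : (q : ℂ) ≠ 0 := by exact_mod_cast hq0.ne'
  have ha0' : (a : ℂ) ≠ 0 := by exact_mod_cast ha0.ne'
  have hq : ‖(q : ℂ)‖ < 1 := by rwa [Complex.norm_of_nonneg hq0.le]
  have ha : ‖(a : ℂ)‖ < 1 := by rwa [Complex.norm_of_nonneg ha0.le]
  have h := hasSum_littleQBessel_mul hq0' hq ha0' ha n m
  exact ⟨h.summable, h.tsum_eq⟩
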